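/- Let (u_ε) be a bounded sequence in L^Φ(Q×Ω), where Φ ∈ Δ₂ has conjugate Φ̃ ∈ Δ₂ so that L^Φ(Q×Ω) is separable reflexive with dual L^{Φ̃}(Q×Ω). Then there exist a subsequence (u_{ε'}) and u₀ ∈ L^Φ(Q×Ω) such that for every f ∈ C_0^∞(Q)⊗C^∞(Ω): ∬_{Q×Ω} u_{ε'}(x,ω) f(x, T(ε'⁻¹x)ω) dx dμ → ∬_{Q×Ω} u₀(x,ω) f(x,ω) dx dμ (weak stochastic two-scale convergence in the mean). -/

import Mathlib

open MeasureTheory Filter Set Topology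

noncomputable def luxNorm {α : Type*} [MeasurableSpace α] (Φ : ℝ → ℝ) (μ : Measure α)
    (f : α → ℝ) : ℝ :=
  sInf {δ : ℝ | 0 < δ ∧ ∫⁻ a, ENNReal.ofReal (Φ (|f a| / δ)) ∂μ ≤ 1}

def MemLPhi {α : Type*} [MeasurableSpace α] (Φ : ℝ → ℝ) (μ : Measure α) (f : α → ℝ) : Prop :=
  Measurable f ∧ ∃ δ > 0, ∫⁻ a, ENNReal.ofReal (Φ (|f a| / δ)) ∂μ < ⊤

structure IsYoung (Φ : ℝ → ℝ) : Prop where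
  continuousOn : ContinuousOn Φ (Ici 0)
  convexOn : ConvexOn ℝ (Ici 0) Φ
  map_zero : Φ 0 = 0
  pos : ∀ t > 0, 0 < Φ t
  tendsto_zero : Tendsto (fun t => Φ t / t) (𝓝[>] (0:ℝ)) (𝓝 0)
  tendsto_top : Tendsto (fun t => Φ t / t) atTop atTop

structure IsYoungDensity (Φ φ : ℝ → ℝ) : Prop where
  mono : MonotoneOn φ (Ici 0)
  rightCont : ∀ t ≥ 0, ContinuousWithinAt φ (Ici t) t
  map_zero : φ 0 = 0
  pos : ∀ t > 0, 0 < φ t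
  tendsto_top : Tendsto φ atTop atTop
  repr : ∀ t ≥ 0, Φ t = ∫ τ in (0:ℝ)..t, φ τ

noncomputable def youngConj (Φ : ℝ → ℝ) (t : ℝ) : ℝ :=
  sSup {y : ℝ | ∃ s ≥ (0:ℝ), y = s * t - Φ s}

def Delta2 (Φ : ℝ → ℝ) : Prop := ∃ t₀ > 0, ∃ k > 2, ∀ t ≥ t₀, Φ (2 * t) ≤ k * Φ t

def DeltaPrime (Φ : ℝ → ℝ) : Prop :=
  ∃ β > 0, ∀ t ≥ (0:ℝ), ∀ s ≥ (0:ℝ), Φ (t * s) ≤ β * Φ t * Φ s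

/-- A family of stochastic derivatives of all orders: `g l` is the iterated stochastic
derivative of `g []`, each `g l` bounded measurable, with the difference quotients along
the dynamical system converging essentially uniformly.  `g []` then belongs to the
space `C^∞(Ω)` of the paper. -/
def StochSmoothFamily {N : ℕ} {Ω : Type*} [MeasurableSpace Ω] (μ : Measure Ω)
    (T : EuclideanSpace ℝ (Fin N) → Ω → Ω) (g : List (Fin N) → Ω → ℝ) : Prop :=
  (∀ l, Measurable (g l) ∧ ∃ C, ∀ ω, |g l ω| ≤ C) ∧
  ∀ l i, Tendsto (fun t : ℝ =>
      essSup (fun ω =>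
        ENNReal.ofReal |(g l (T (t • EuclideanSpace.single i 1) ω) - g l ω) / t - g (i :: l) ω|) μ)
    (𝓝[≠] (0:ℝ)) (𝓝 0)

theorem exists_subseq_forall_tendsto_inner {H : Type*} [NormedAddCommGroup H]
    [InnerProductSpace ℝ H] [CompleteSpace H] (h : ℕ → ℕ → H) (B : ℕ → ℝ)
    (hB : ∀ i n, ‖h i n‖ ≤ B i) :
    ∃ σ : ℕ → ℕ, StrictMono σ ∧ ∀ i, ∃ w : H, ∀ y,
      Tendsto (fun k => inner ℝ (h i (σ k)) y) atTop (𝓝 (inner ℝ w y)) := by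
  obtain ⟨a, -, σ, hσ, hlim⟩ := (isCompact_univ_pi (X := fun _ : ℕ × ℕ × ℕ => ℝ)
    (s := fun q => Icc (-(B q.1 * B q.2.1)) (B q.1 * B q.2.1))
    fun _ => isCompact_Icc).tendsto_subseq
    (x := fun n q => inner ℝ (h q.1 n) (h q.2.1 q.2.2)) (by
      intro n q _
      rw [mem_Icc, ← abs_le]
      refine (abs_real_inner_le_norm _ _).trans ?_
      have := (norm_nonneg _).trans (hB q.1 n)
      gcongr <;> apply hB)
  refine ⟨σ, hσ, fun i => ?_⟩
  have hpt : ∀ j l, CauchySeq fun k => inner ℝ (h i (σ k)) (h j l) := fun j l =>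
    ((tendsto_pi_nhds.1 hlim) (i, j, l)).cauchySeq
  let S : Submodule ℝ H := Submodule.span ℝ (range fun q : ℕ × ℕ => h q.1 q.2)
  have hspan : ∀ y ∈ S, CauchySeq fun k => inner ℝ (h i (σ k)) y := by
    intro y hy
    induction hy using Submodule.span_induction with
    | mem x hx => obtain ⟨q, rfl⟩ := hx; exact hpt _ _
    | zero => simpa using cauchySeq_const (0 : ℝ)
    | add x y _ _ hx hy =>
      simp only [inner_add_right]
      exact hx.add hy
    | smul c x _ hx =>
      obtain ⟨l, hl⟩ := cauchySeq_tendsto_of_complete hx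
      simp only [inner_smul_right]
      exact (hl.const_mul c).cauchySeq
  have hclos : ∀ y ∈ S.topologicalClosure, CauchySeq fun k => inner ℝ (h i (σ k)) y := by
    intro y hy
    rw [Metric.cauchySeq_iff']
    intro η hη
    have hBi : 0 ≤ B i := (norm_nonneg _).trans (hB i 0)
    obtain ⟨z, hz, hyz⟩ := Metric.mem_closure_iff.1
      (show y ∈ closure (S : Set H) from hy) (η / (3 * (B i + 1))) (by positivity)
    obtain ⟨N, hN⟩ := Metric.cauchySeq_iff'.1 (hspan z hz) (η / 3) (by positivity)
    refine ⟨N, fun n hn => ?_⟩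
    have key : ∀ k, dist (inner ℝ (h i (σ k)) y) (inner ℝ (h i (σ k)) z) < η / 3 := by
      intro k
      rw [Real.dist_eq, ← inner_sub_right]
      refine (abs_real_inner_le_norm _ _).trans_lt ?_
      rw [dist_eq_norm] at hyz
      calc ‖h i (σ k)‖ * ‖y - z‖ ≤ (B i + 1) * ‖y - z‖ := by
            gcongr; linarith [hB i (σ k)]
        _ < (B i + 1) * (η / (3 * (B i + 1))) := by gcongr
        _ = η / 3 := by field_simp
    have h1 := key n
    have h2 := key N
    have h3 := hN n hn
    rw [Real.dist_eq, abs_lt] at *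
    constructor <;> linarith
  have hall : ∀ y, ∃ l, Tendsto (fun k => inner ℝ (h i (σ k)) y) atTop (𝓝 l) := by
    intro y
    have : IsClosed (S.topologicalClosure : Set H) := S.isClosed_topologicalClosure
    have : CompleteSpace S.topologicalClosure := this.completeSpace_coe
    obtain ⟨p, hp, q, hq, rfl⟩ := S.topologicalClosure.exists_add_mem_mem_orthogonal y
    obtain ⟨l, hl⟩ := cauchySeq_tendsto_of_complete (hclos p hp)
    refine ⟨l, hl.congr fun k => ?_⟩
    rw [inner_add_right, (Submodule.mem_orthogonal _ _).1 hq (h i (σ k)), add_zero]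
    exact S.le_topologicalClosure (Submodule.subset_span ⟨(i, σ k), rfl⟩)
  choose L hL using hall
  let F : H →L[ℝ] ℝ := continuousLinearMapOfTendsto (fun k => innerSL ℝ (h i (σ k)))
    (f := L) (tendsto_pi_nhds.2 fun y => by simpa using hL y)
  refine ⟨(InnerProductSpace.toDual ℝ H).symm F, fun y => ?_⟩
  rw [InnerProductSpace.toDual_symm_apply]
  exact hL y

theorem abs_integral_mul_sub_integral_mul_le {X : Type*} [MeasurableSpace X] {m : Measure X}
    {g h f : X → ℝ} (hg : Integrable g m) (hh : Integrable h m) (hf : Measurable f) {K : ℝ}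
    (hK : ∀ x, |f x| ≤ K) :
    |∫ x, g x * f x ∂m - ∫ x, h x * f x ∂m| ≤ K * ∫ x, |g x - h x| ∂m := by
  have hgf := hg.mul_bdd (c := K) hf.aestronglyMeasurable (ae_of_all _ hK)
  have hhf := hh.mul_bdd (c := K) hf.aestronglyMeasurable (ae_of_all _ hK)
  rw [← integral_sub hgf hhf, ← integral_const_mul]
  refine (abs_integral_le_integral_abs).trans ?_
  refine integral_mono (hgf.sub hhf).abs ((hg.sub hh).abs.const_mul K) fun x => ?_
  simp only [← sub_mul, abs_mul]
  rw [mul_comm]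
  exact mul_le_mul_of_nonneg_right (hK x) (abs_nonneg _)

theorem exists_subseq_tendsto_integral_mul_of_bounded {X : Type*} [MeasurableSpace X]
    {m : Measure X} [IsFiniteMeasure m] (b : ℕ → ℕ → X → ℝ) (hbm : ∀ M n, Measurable (b M n))
    (B : ℕ → ℝ) (hbB : ∀ M n x, |b M n x| ≤ B M) :
    ∃ σ : ℕ → ℕ, StrictMono σ ∧ ∀ M, ∃ w : X → ℝ, Measurable w ∧ Integrable w m ∧
      ∀ f : X → ℝ, Measurable f → (∃ K, ∀ x, |f x| ≤ K) →
        Tendsto (fun k => ∫ x, b M (σ k) x * f x ∂m) atTop (𝓝 (∫ x, w x * f x ∂m)) := by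
  have hmem : ∀ f : X → ℝ, Measurable f → ∀ K, (∀ x, |f x| ≤ K) → MemLp f 2 m :=
    fun f hf K hK => MemLp.of_bound hf.aestronglyMeasurable K (ae_of_all _ hK)
  have hb2 := fun M n => hmem _ (hbm M n) _ (hbB M n)
  obtain ⟨σ, hσ, h⟩ := exists_subseq_forall_tendsto_inner (H := Lp ℝ 2 m)
    (fun M n => (hb2 M n).toLp) (fun M => m.real univ ^ (2 : ENNReal).toReal⁻¹ * B M) (by
      intro M n
      rcases isEmpty_or_nonempty X with hX | ⟨⟨x₀⟩⟩
      · have : m = 0 := Measure.eq_zero_of_isEmpty m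
        subst this
        simp [Lp.norm_def]
      refine Lp.norm_le_of_ae_bound ((abs_nonneg _).trans (hbB M n x₀)) ?_
      filter_upwards [(hb2 M n).coeFn_toLp] with x hx
      rw [hx]; exact hbB M n x)
  refine ⟨σ, hσ, fun M => ?_⟩
  obtain ⟨w, hw⟩ := h M
  refine ⟨w, (Lp.stronglyMeasurable w).measurable, (Lp.memLp w).integrable one_le_two,
    fun f hf ⟨K, hK⟩ => ?_⟩
  have hf2 := hmem f hf K hK
  have := hw hf2.toLp
  simp only [L2.inner_def, RCLike.inner_apply, conj_trivial] at this
  convert this using 2 with k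
  · refine integral_congr_ae ?_
    filter_upwards [hf2.coeFn_toLp, (hb2 M (σ k)).coeFn_toLp] with x h1 h2
    rw [h1, h2, mul_comm]
  · refine integral_congr_ae ?_
    filter_upwards [hf2.coeFn_toLp] with x h1
    rw [h1, mul_comm]

theorem exists_subseq_tendsto_integral_mul_of_approx {X : Type*} [MeasurableSpace X]
    {m : Measure X} [IsFiniteMeasure m] (v : ℕ → X → ℝ) (hv : ∀ n, Integrable (v n) m)
    (b : ℕ → ℕ → X → ℝ) (hbm : ∀ M n, Measurable (b M n))
    (B : ℕ → ℝ) (hbB : ∀ M n x, |b M n x| ≤ B M) (δ : ℕ → ℝ) (hδ : Tendsto δ atTop (𝓝 0))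
    (hvb : ∀ M n, ∫ x, |b M n x - v n x| ∂m ≤ δ M) :
    ∃ σ : ℕ → ℕ, StrictMono σ ∧ ∃ w : X → ℝ, Measurable w ∧ Integrable w m ∧
      ∀ f : X → ℝ, Measurable f → (∃ K, ∀ x, |f x| ≤ K) →
        Tendsto (fun k => ∫ x, v (σ k) x * f x ∂m) atTop (𝓝 (∫ x, w x * f x ∂m)) := by
  obtain ⟨σ, hσ, h⟩ := exists_subseq_tendsto_integral_mul_of_bounded (m := m) b hbm B hbB
  choose W hWm hWi hW using h
  have hbi : ∀ M n, Integrable (b M n) m := fun M n =>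
    Integrable.of_bound (hbm M n).aestronglyMeasurable (B M) (ae_of_all _ (hbB M n))
  have hWW : ∀ M M', ∫ x, |W M x - W M' x| ∂m ≤ δ M + δ M' := by
    intro M M'
    let s : X → ℝ := fun x => if 0 ≤ W M x - W M' x then 1 else -1
    have hs : Measurable s := Measurable.ite
      (measurableSet_le measurable_const ((hWm M).sub (hWm M'))) measurable_const measurable_const
    have hs1 : ∀ x, |s x| ≤ 1 := by
      intro x; simp only [s]; split_ifs <;> simp
    have hlim := (hW M s hs ⟨1, hs1⟩).sub (hW M' s hs ⟨1, hs1⟩)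
    have heq : ∫ x, W M x * s x ∂m - ∫ x, W M' x * s x ∂m = ∫ x, |W M x - W M' x| ∂m := by
      rw [← integral_sub ((hWi M).mul_bdd (c := 1) hs.aestronglyMeasurable (ae_of_all _ hs1))
        ((hWi M').mul_bdd (c := 1) hs.aestronglyMeasurable (ae_of_all _ hs1))]
      congr 1 with x
      rw [← sub_mul]
      simp only [s]
      split_ifs with h0
      · rw [abs_of_nonneg h0, mul_one]
      · rw [abs_of_neg (not_le.1 h0), mul_neg_one]
    rw [heq] at hlim
    refine le_of_tendsto' hlim fun k => ?_
    have h1 := abs_le.1 (abs_integral_mul_sub_integral_mul_le (hbi M (σ k)) (hv (σ k)) hs hs1)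
    have h2 := abs_le.1 (abs_integral_mul_sub_integral_mul_le (hbi M' (σ k)) (hv (σ k)) hs hs1)
    linarith [hvb M (σ k), hvb M' (σ k)]
  have hnorm : ∀ M (g : Lp ℝ 1 m), ‖(hWi M).toL1 - g‖ = ∫ x, |W M x - g x| ∂m := by
    intro M g
    rw [L1.norm_eq_integral_norm]
    refine integral_congr_ae ?_
    filter_upwards [Lp.coeFn_sub (hWi M).toL1 g, (hWi M).coeFn_toL1] with x h1 h2
    rw [h1, Pi.sub_apply, h2, Real.norm_eq_abs]
  have hcauchy : CauchySeq fun M => (hWi M).toL1 := by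
    rw [Metric.cauchySeq_iff]
    intro η hη
    obtain ⟨N, hN⟩ := eventually_atTop.1 (hδ.eventually_lt_const (half_pos hη))
    refine ⟨N, fun M hM M' hM' => ?_⟩
    rw [dist_eq_norm, hnorm]
    calc _ = ∫ x, |W M x - W M' x| ∂m := by
          refine integral_congr_ae ?_
          filter_upwards [(hWi M').coeFn_toL1] with x hx
          rw [hx]
      _ < η := by linarith [hWW M M', hN M hM, hN M' hM']
  obtain ⟨w, hw⟩ := cauchySeq_tendsto_of_complete hcauchy
  have hwi : Integrable w m := L1.integrable_coeFn w
  refine ⟨σ, hσ, w, (Lp.stronglyMeasurable w).measurable, hwi, fun f hf ⟨K, hK⟩ => ?_⟩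
  have hunif : TendstoUniformly (fun M k => ∫ x, b M (σ k) x * f x ∂m)
      (fun k => ∫ x, v (σ k) x * f x ∂m) atTop := by
    rw [Metric.tendstoUniformly_iff]
    intro η hη
    have h0 : Tendsto (fun M => |K| * δ M) atTop (𝓝 0) := by simpa using hδ.const_mul |K|
    filter_upwards [h0.eventually_lt_const hη] with M hM k
    rw [dist_comm, Real.dist_eq]
    refine (abs_integral_mul_sub_integral_mul_le (hbi M (σ k)) (hv (σ k)) hf
      fun x => (hK x).trans (le_abs_self K)).trans_lt (lt_of_le_of_lt ?_ hM)
    exact mul_le_mul_of_nonneg_left (hvb _ _) (abs_nonneg K)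
  refine hunif.tendsto_of_eventually_tendsto
    (Eventually.of_forall fun M => hW M f hf ⟨K, hK⟩) ?_
  rw [tendsto_iff_dist_tendsto_zero] at hw ⊢
  refine squeeze_zero (fun _ => dist_nonneg) (fun M => ?_) (by simpa using hw.const_mul K)
  rw [Real.dist_eq, dist_eq_norm, hnorm]
  exact abs_integral_mul_sub_integral_mul_le (hWi M) hwi hf hK

theorem IsYoung.nonneg {Φ : ℝ → ℝ} (hY : IsYoung Φ) {t : ℝ} (ht : 0 ≤ t) : 0 ≤ Φ t := by
  rcases ht.eq_or_lt with rfl | h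
  · exact hY.map_zero.ge
  · exact (hY.pos t h).le

theorem IsYoung.monotoneOn {Φ : ℝ → ℝ} (hY : IsYoung Φ) : MonotoneOn Φ (Ici 0) := by
  intro s hs t ht hst
  rcases (show (0 : ℝ) ≤ s from hs).eq_or_lt with rfl | h
  · rw [hY.map_zero]; exact hY.nonneg ht
  have ht0 : 0 < t := h.trans_le hst
  have hc := hY.convexOn.2 self_mem_Ici ht (sub_nonneg.2 ((div_le_one ht0).2 hst))
    (div_nonneg h.le ht0.le) (sub_add_cancel 1 (s / t))
  simp only [smul_eq_mul, mul_zero, zero_add, hY.map_zero, div_mul_cancel₀ _ ht0.ne'] at hc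
  refine hc.trans (mul_le_of_le_one_left (hY.nonneg ht) ?_)
  rw [div_le_one ht0]; exact hst

theorem IsYoung.continuous_comp_abs_div {Φ : ℝ → ℝ} (hY : IsYoung Φ) {C : ℝ} (hC : 0 < C) :
    Continuous fun t => Φ (|t| / C) :=
  hY.continuousOn.comp_continuous (by fun_prop) fun t => div_nonneg (abs_nonneg t) hC.le

theorem IsYoung.convexOn_comp_abs_div {Φ : ℝ → ℝ} (hY : IsYoung Φ) {C : ℝ} (hC : 0 < C) :
    ConvexOn ℝ univ fun t => Φ (|t| / C) := by
  refine ⟨convex_univ, fun x _ y _ a b ha hb hab => ?_⟩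
  have hx : |x| / C ∈ Ici (0 : ℝ) := div_nonneg (abs_nonneg x) hC.le
  have hy : |y| / C ∈ Ici (0 : ℝ) := div_nonneg (abs_nonneg y) hC.le
  have hxy := hY.convexOn.1 hx hy ha hb hab
  refine le_trans (hY.monotoneOn (div_nonneg (abs_nonneg _) hC.le) hxy ?_)
    (hY.convexOn.2 hx hy ha hb hab)
  simp only [smul_eq_mul]
  calc |a * x + b * y| / C ≤ (a * |x| + b * |y|) / C := by
        gcongr
        refine (abs_add_le _ _).trans ?_
        rw [abs_mul, abs_mul, abs_of_nonneg ha, abs_of_nonneg hb]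
    _ = a * (|x| / C) + b * (|y| / C) := by ring

theorem ConvexOn.exists_monotone_subgradient {Ψ : ℝ → ℝ} (hΨ : ConvexOn ℝ univ Ψ) :
    ∃ g : ℝ → ℝ, Monotone g ∧ ∀ x y, Ψ x + g x * (y - x) ≤ Ψ y := by
  refine ⟨fun x => derivWithin Ψ (Ioi x) x, ?_, fun x y => ?_⟩
  · have := hΨ.monotoneOn_rightDeriv
    rwa [interior_univ, monotoneOn_univ] at this
  · rcases lt_trichotomy x y with h | rfl | h
    · have := hΨ.rightDeriv_le_slope_of_mem_interior (x := x) (y := y) (by simp) trivial h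
      rw [slope_def_field, le_div_iff₀ (sub_pos.2 h)] at this
      linarith
    · simp
    · have h1 := hΨ.slope_le_leftDeriv_of_mem_interior (x := y) (y := x) trivial (by simp) h
      have h2 := h1.trans (hΨ.leftDeriv_le_rightDeriv_of_mem_interior (x := x) (by simp))
      rw [slope_def_field, div_le_iff₀ (sub_pos.2 h)] at h2
      linarith

theorem lintegral_convex_le_of_tendsto_integral_mul {X : Type*} [MeasurableSpace X]
    {m : Measure X} [IsFiniteMeasure m] {Ψ : ℝ → ℝ} (hΨ : ConvexOn ℝ univ Ψ)
    (hΨc : Continuous Ψ) (hΨ0 : ∀ t, 0 ≤ Ψ t) {v : ℕ → X → ℝ} (hv : ∀ n, Integrable (v n) m)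
    {w : X → ℝ} (hwm : Measurable w) (hwi : Integrable w m)
    (hvw : ∀ f : X → ℝ, Measurable f → (∃ K, ∀ x, |f x| ≤ K) →
      Tendsto (fun k => ∫ x, v k x * f x ∂m) atTop (𝓝 (∫ x, w x * f x ∂m)))
    (hv1 : ∀ n, ∫⁻ x, ENNReal.ofReal (Ψ (v n x)) ∂m ≤ 1) :
    ∫⁻ x, ENNReal.ofReal (Ψ (w x)) ∂m ≤ 1 := by
  obtain ⟨g, hg, hgΨ⟩ := hΨ.exists_monotone_subgradient
  let A : ℕ → Set X := fun K => {x | |w x| ≤ K}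
  have hA : ∀ K, MeasurableSet (A K) := fun K => measurableSet_le hwm.abs measurable_const
  have hAmono : Monotone A := fun K L h x (hx : |w x| ≤ K) => hx.trans (Nat.cast_le.2 h)
  have hAU : ⋃ K, A K = univ := by
    refine eq_univ_of_forall fun x => mem_iUnion.2 ?_
    exact exists_nat_ge |w x|
  rw [← setLIntegral_univ, ← hAU, setLIntegral_iUnion_of_directed _ hAmono.directed_le]
  refine iSup_le fun K => ?_
  have hΨv : ∀ n, Integrable (fun x => Ψ (v n x)) m := fun n => by
    refine ⟨hΨc.comp_aestronglyMeasurable (hv n).aestronglyMeasurable, ?_⟩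
    rw [hasFiniteIntegral_iff_ofReal (ae_of_all _ fun x => hΨ0 _)]
    exact (hv1 n).trans_lt ENNReal.one_lt_top
  have hΨw : IntegrableOn (fun x => Ψ (w x)) (A K) m := by
    obtain ⟨c, hc⟩ := (isCompact_Icc (a := -(K : ℝ)) (b := K)).exists_bound_of_continuousOn
      hΨc.continuousOn
    refine Integrable.of_bound (hΨc.comp_aestronglyMeasurable
      hwi.aestronglyMeasurable).restrict c ?_
    exact (ae_restrict_iff' (hA K)).2 (ae_of_all _ fun x hx => hc _ (abs_le.1 hx))
  rw [← ofReal_integral_eq_lintegral_ofReal hΨw (ae_of_all _ fun x => hΨ0 _),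
    ENNReal.ofReal_le_one]
  let f : X → ℝ := (A K).indicator fun x => g (w x)
  have hf : Measurable f := (hg.measurable.comp hwm).indicator (hA K)
  have hfb : ∀ x, |f x| ≤ max |g (-K)| |g K| := by
    intro x
    by_cases hx : x ∈ A K
    · simp only [f, indicator_of_mem hx]
      have := abs_le.1 (show |w x| ≤ K from hx)
      exact abs_le_max_abs_abs (hg this.1) (hg this.2)
    · simp only [f, indicator_of_notMem hx, abs_zero]
      positivity
  have hmul : ∀ {h : X → ℝ}, Integrable h m → Integrable (fun x => h x * f x) m := fun hh =>
    hh.mul_bdd hf.aestronglyMeasurable (ae_of_all _ hfb)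
  have hlim := (hvw f hf ⟨_, hfb⟩).const_add (∫ x in A K, Ψ (w x) ∂m - ∫ x, w x * f x ∂m)
  rw [sub_add_cancel] at hlim
  refine le_of_tendsto' hlim fun n => ?_
  have hΨw' := hΨw.integrable_indicator (hA K)
  rw [← integral_indicator (hA K), ← integral_sub' hΨw' (hmul hwi),
    ← integral_add' (hΨw'.sub (hmul hwi)) (hmul (hv n))]
  calc _ ≤ ∫ x, Ψ (v n x) ∂m := by
        refine integral_mono ((hΨw'.sub (hmul hwi)).add (hmul (hv n))) (hΨv n) fun x => ?_
        simp only [Pi.add_apply, Pi.sub_apply]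
        by_cases hx : x ∈ A K
        · simp only [f, indicator_of_mem hx]
          linarith [hgΨ (w x) (v n x)]
        · simp only [f, indicator_of_notMem hx]
          simpa using hΨ0 (v n x)
    _ ≤ 1 := by
        rw [integral_eq_lintegral_of_nonneg_ae (ae_of_all _ fun x => hΨ0 _)
          (hΨv n).aestronglyMeasurable]
        exact ENNReal.toReal_le_of_le_ofReal zero_le_one (by simpa using hv1 n)

theorem IsYoung.exists_subseq_tendsto_integral_mul {X : Type*} [MeasurableSpace X]
    {m : Measure X} [IsFiniteMeasure m] {Φ : ℝ → ℝ} (hY : IsYoung Φ) {C : ℝ} (hC : 0 < C)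
    (v : ℕ → X → ℝ) (hvm : ∀ n, Measurable (v n))
    (hv1 : ∀ n, ∫⁻ x, ENNReal.ofReal (Φ (|v n x| / C)) ∂m ≤ 1) :
    ∃ σ : ℕ → ℕ, StrictMono σ ∧ ∃ w : X → ℝ, Measurable w ∧
      ∫⁻ x, ENNReal.ofReal (Φ (|w x| / C)) ∂m ≤ 1 ∧
      ∀ f : X → ℝ, Measurable f → (∃ K, ∀ x, |f x| ≤ K) →
        Tendsto (fun k => ∫ x, v (σ k) x * f x ∂m) atTop (𝓝 (∫ x, w x * f x ∂m)) := by
  have hΨ0 : ∀ t, 0 ≤ Φ (|t| / C) := fun t => hY.nonneg (div_nonneg (abs_nonneg t) hC.le)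
  have hΨc := hY.continuous_comp_abs_div hC
  have hΨv : ∀ n, Integrable (fun x => Φ (|v n x| / C)) m := fun n => by
    refine ⟨(hΨc.measurable.comp (hvm n)).aestronglyMeasurable, ?_⟩
    rw [hasFiniteIntegral_iff_ofReal (ae_of_all _ fun x => hΨ0 _)]
    exact (hv1 n).trans_lt ENNReal.one_lt_top
  have hΨ1 : ∀ n, ∫ x, Φ (|v n x| / C) ∂m ≤ 1 := fun n => by
    rw [integral_eq_lintegral_of_nonneg_ae (ae_of_all _ fun x => hΨ0 _)
      (hΨv n).aestronglyMeasurable]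
    exact ENNReal.toReal_le_of_le_ofReal zero_le_one (by simpa using hv1 n)
  have hsup : ∀ k : ℕ, ∃ R > 0, ∀ t, R < |t| → |t| ≤ C / (k + 1) * Φ (|t| / C) := by
    intro k
    obtain ⟨r, hr⟩ := eventually_atTop.1 (hY.tendsto_top.eventually_ge_atTop ((k : ℝ) + 1))
    refine ⟨C * max r 1, by positivity, fun t ht => ?_⟩
    have hrt : max r 1 ≤ |t| / C := by
      rw [le_div_iff₀ hC, mul_comm]; exact ht.le
    have ht0 : 0 < |t| / C := lt_of_lt_of_le (by positivity) hrt
    have h := hr _ ((le_max_left _ _).trans hrt)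
    rw [le_div_iff₀ ht0] at h
    calc |t| = C / (k + 1) * ((k + 1) * (|t| / C)) := by field_simp
      _ ≤ _ := by gcongr
  choose R hR0 hR using hsup
  have hb : ∀ M t, |max (-R M) (min t (R M))| ≤ R M := fun M t =>
    abs_le.2 ⟨le_max_left _ _, max_le (by linarith [hR0 M]) (min_le_right _ _)⟩
  have hbt : ∀ M t, |max (-R M) (min t (R M)) - t| ≤ C / (M + 1) * Φ (|t| / C) := by
    intro M t
    rcases le_or_gt |t| (R M) with h | h
    · obtain ⟨h1, h2⟩ := abs_le.1 h
      rw [min_eq_left h2, max_eq_right h1, sub_self, abs_zero]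
      exact mul_nonneg (by positivity) (hΨ0 t)
    · refine le_trans ?_ (hR M t h)
      have := hR0 M
      rcases lt_abs.1 h with h' | h'
      · rw [min_eq_right h'.le, max_eq_right (by linarith), abs_of_nonpos (by linarith),
          abs_of_pos (by linarith)]
        linarith
      · rw [min_eq_left (by linarith), max_eq_left (by linarith), abs_of_nonneg (by linarith),
          abs_of_neg (by linarith)]
        linarith
  have hbm : ∀ M n, Measurable fun x => max (-R M) (min (v n x) (R M)) := fun M n =>
    measurable_const.max ((hvm n).min measurable_const)
  have hbi : ∀ M n, Integrable (fun x => max (-R M) (min (v n x) (R M))) m := fun M n =>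
    Integrable.of_bound (hbm M n).aestronglyMeasurable (R M) (ae_of_all _ fun x => hb M _)
  have hdi : ∀ M n, Integrable (fun x => max (-R M) (min (v n x) (R M)) - v n x) m :=
    fun M n => ((hΨv n).const_mul (C / (M + 1))).mono'
      ((hbm M n).sub (hvm n)).aestronglyMeasurable (ae_of_all _ fun x => hbt M _)
  have hvi : ∀ n, Integrable (v n) m := fun n => by
    refine ((hbi 0 n).sub (hdi 0 n)).congr (ae_of_all _ fun x => ?_)
    exact sub_sub_cancel _ _
  obtain ⟨σ, hσ, w, hwm, hwi, hw⟩ := exists_subseq_tendsto_integral_mul_of_approx (m := m) v hvi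
    (fun M n x => max (-R M) (min (v n x) (R M))) hbm R (fun M n x => hb M _)
    (fun M => C / (M + 1)) (tendsto_const_div_atTop_nhds_zero_nat C |>.comp
      (tendsto_add_atTop_nat 1) |>.congr fun M => by simp) (by
      intro M n
      calc _ ≤ ∫ x, C / (M + 1) * Φ (|v n x| / C) ∂m :=
            integral_mono (hdi M n).abs ((hΨv n).const_mul _) fun x => hbt M _
        _ ≤ C / (M + 1) := by
            rw [integral_const_mul]
            exact mul_le_of_le_one_right (by positivity) (hΨ1 n))
  exact ⟨σ, hσ, w, hwm, lintegral_convex_le_of_tendsto_integral_mul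
    (hY.convexOn_comp_abs_div hC) hΨc hΨ0 (fun n => hvi (σ n)) hwm hwi hw fun n => hv1 (σ n), hw⟩

theorem measurePreserving_prodMk_flow {N : ℕ} {Ω : Type*} [MeasurableSpace Ω]
    {μ : Measure Ω} [IsProbabilityMeasure μ] {T : EuclideanSpace ℝ (Fin N) → Ω → Ω}
    (hTmp : ∀ x, MeasurePreserving (T x) μ μ)
    (hTjm : Measurable fun p : EuclideanSpace ℝ (Fin N) × Ω => T p.1 p.2)
    (ν : Measure (EuclideanSpace ℝ (Fin N))) [SFinite ν] (c : ℝ) :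
    MeasurePreserving (fun p : EuclideanSpace ℝ (Fin N) × Ω => (p.1, T (c • p.1) p.2))
      (ν.prod μ) (ν.prod μ) :=
  (MeasurePreserving.id ν).skew_product (g := fun x ω => T (c • x) ω)
    (hTjm.comp ((measurable_fst.const_smul c).prodMk measurable_snd))
    (ae_of_all _ fun x => (hTmp (c • x)).map_eq)

theorem stmt18 {N : ℕ} {Ω : Type*} [MeasurableSpace Ω]
    (Φ : ℝ → ℝ) (hY : IsYoung Φ) (hΔ : Delta2 Φ) (hΔconj : Delta2 (youngConj Φ))
    (Q : Set (EuclideanSpace ℝ (Fin N))) (hQo : IsOpen Q) (hQb : Bornology.IsBounded Q)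
    (μ : Measure Ω) [IsProbabilityMeasure μ]
    (T : EuclideanSpace ℝ (Fin N) → Ω → Ω)
    (hT0 : T 0 = id) (hTgrp : ∀ x y, T (x + y) = T x ∘ T y)
    (hTmp : ∀ x, MeasurePreserving (T x) μ μ)
    (hTjm : Measurable fun p : EuclideanSpace ℝ (Fin N) × Ω => T p.1 p.2)
    (ε : ℕ → ℝ) (hε : ∀ n, 0 < ε n ∧ ε n ≤ 1) (hε0 : Tendsto ε atTop (𝓝 0))
    (u : ℕ → EuclideanSpace ℝ (Fin N) × Ω → ℝ) (hum : ∀ n, Measurable (u n))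
    (hub : ∃ C > (0:ℝ), ∀ n,
      ∫⁻ p, ENNReal.ofReal (Φ (|u n p| / C)) ∂((volume.restrict Q).prod μ) ≤ 1) :
    ∃ σ : ℕ → ℕ, StrictMono σ ∧ ∃ u₀, MemLPhi Φ ((volume.restrict Q).prod μ) u₀ ∧
      ∀ (φ : EuclideanSpace ℝ (Fin N) → ℝ) (Dψ : List (Fin N) → Ω → ℝ),
        ContDiff ℝ (⊤ : ℕ∞) φ → HasCompactSupport φ → tsupport φ ⊆ Q →
        StochSmoothFamily μ T Dψ →
        Tendsto (fun k =>
            ∫ p, u (σ k) p * (φ p.1 * Dψ [] (T ((ε (σ k))⁻¹ • p.1) p.2))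
              ∂((volume.restrict Q).prod μ))
          atTop (𝓝 (∫ p, u₀ p * (φ p.1 * Dψ [] p.2) ∂((volume.restrict Q).prod μ))) := by
  obtain ⟨C, hC, hu1⟩ := hub
  have : IsFiniteMeasure (volume.restrict Q) :=
    isFiniteMeasure_restrict.2 hQb.measure_lt_top.ne
  let S : ℝ → EuclideanSpace ℝ (Fin N) × Ω → EuclideanSpace ℝ (Fin N) × Ω :=
    fun c p => (p.1, T (c • p.1) p.2)
  have hS : ∀ c, MeasurePreserving (S c) ((volume.restrict Q).prod μ)
      ((volume.restrict Q).prod μ) := measurePreserving_prodMk_flow hTmp hTjm _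
  have hSS : ∀ c p, S (-c) (S c p) = p := fun c p => by
    simp only [S, neg_smul, ← Function.comp_apply (f := T (-(c • p.1))), ← hTgrp,
      neg_add_cancel, hT0, id]
  obtain ⟨σ, hσ, w, hwm, hw1, hw⟩ := hY.exists_subseq_tendsto_integral_mul
    (m := (volume.restrict Q).prod μ) hC (fun n => u n ∘ S (-(ε n)⁻¹))
    (fun n => (hum n).comp (hS _).measurable) (fun n => by
      refine le_of_eq_of_le ?_ (hu1 n)
      exact (hS (-(ε n)⁻¹)).lintegral_comp (f := fun p => ENNReal.ofReal (Φ (|u n p| / C)))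
        ((hY.continuous_comp_abs_div hC).measurable.comp (hum n)).ennreal_ofReal)
  refine ⟨σ, hσ, w, ⟨hwm, C, hC, hw1.trans_lt ENNReal.one_lt_top⟩, ?_⟩
  intro φ Dψ hφ hφc _ hψ
  obtain ⟨hψm, K, hK⟩ := hψ.1 []
  obtain ⟨L, hL⟩ := hφc.exists_bound_of_continuous hφ.continuous
  have hfm : Measurable fun p : EuclideanSpace ℝ (Fin N) × Ω => φ p.1 * Dψ [] p.2 :=
    (hφ.continuous.measurable.comp measurable_fst).mul (hψm.comp measurable_snd)
  refine (hw _ hfm ⟨L * K, fun p => ?_⟩).congr fun k => ?_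
  · rw [abs_mul]
    exact mul_le_mul (hL _) (hK _) (abs_nonneg _) ((norm_nonneg _).trans (hL p.1))
  · have h := integral_map (μ := (volume.restrict Q).prod μ)
      (hS (ε (σ k))⁻¹).measurable.aemeasurable
      (((hum (σ k)).comp (hS (-(ε (σ k))⁻¹)).measurable).mul hfm).aestronglyMeasurable
    rw [(hS _).map_eq] at h
    simp only [Pi.mul_apply, Function.comp_apply, hSS] at h
    exact h
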